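/- Let X be a set, f : X → X a map, ψ : X → ℝ a function, r ≥ 0, x ∈ X and n ∈ ℕ. Write S_k ψ(x) = ∑_{i=0}^{k-1} ψ(f^i x) (so S_0 ψ(x) = 0). Let p̂ be the largest integer with 0 ≤ p̂ ≤ n and S_{p̂} ψ(x) ≥ −r p̂ (which exists since S_0 ψ(x) = 0 ≥ 0). Then for every integer j with 1 ≤ j ≤ n − p̂ one has S_j ψ(f^{p̂}(x)) < −r j. In other words, setting P = {(y,m) ∈ X × ℕ : S_m ψ(y) ≥ −r m} and G = {(y,m) ∈ X × ℕ : S_j ψ(y) < −r j for all 1 ≤ j ≤ m}, every orbit segment (x,n) decomposes as (x,p̂) ∈ P followed by (f^{p̂}(x), n − p̂) ∈ G. -/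

import Mathlib

/-- Birkhoff sum `S_k ψ(x) = ∑_{i=0}^{k-1} ψ(f^i x)`. -/
noncomputable def birkhoff {X : Type*} (f : X → X) (ψ : X → ℝ) (k : ℕ) (x : X) : ℝ :=
  ∑ i ∈ Finset.range k, ψ (f^[i] x)

/-- Birkhoff sums satisfy the cocycle identity. -/
theorem birkhoff_add {X : Type*} (f : X → X) (ψ : X → ℝ) (m k : ℕ) (x : X) :
    birkhoff f ψ (m + k) x = birkhoff f ψ m x + birkhoff f ψ k (f^[m] x) := by
  simp only [birkhoff, Finset.sum_range_add, ← Function.iterate_add_apply, Nat.add_comm _ m]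

/-- If `p̂` is the largest integer `≤ n` with `S_{p̂} ψ(x) ≥ −r p̂`, then
`S_j ψ(f^{p̂} x) < −r j` for all `1 ≤ j ≤ n − p̂`; i.e. the orbit segment `(x,n)`
decomposes as a prefix `(x, p̂) ∈ P` followed by `(f^{p̂} x, n − p̂) ∈ G`. -/
theorem orbit_decomposition {X : Type*} (f : X → X) (ψ : X → ℝ) (r : ℝ) (hr : 0 ≤ r)
    (x : X) (n : ℕ) (phat : ℕ) (hphat : phat ≤ n)
    (hP : birkhoff f ψ phat x ≥ -r * phat)
    (hmax : ∀ m : ℕ, phat < m → m ≤ n → birkhoff f ψ m x < -r * m) :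
    (∀ j : ℕ, 1 ≤ j → j ≤ n - phat → birkhoff f ψ j (f^[phat] x) < -r * j) ∧
    (x, phat) ∈ {p : X × ℕ | birkhoff f ψ p.2 p.1 ≥ -r * p.2} ∧
    (f^[phat] x, n - phat) ∈
      {p : X × ℕ | ∀ j : ℕ, 1 ≤ j → j ≤ p.2 → birkhoff f ψ j p.1 < -r * j} := by
  have key : ∀ j : ℕ, 1 ≤ j → j ≤ n - phat → birkhoff f ψ j (f^[phat] x) < -r * j := by
    intro j hj hjn
    have h := hmax (phat + j) (by omega) (by omega)
    rw [birkhoff_add] at h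
    push_cast at h
    linarith
  exact ⟨key, hP, key⟩
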